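/- Let q be a prime power and let k, n, d be positive integers with d ≤ k and 2k ≤ n. Then A_q(n,d,k) ≥ Σ_{i=0}^{⌊(n−2k)/d⌋} q^{(k−d+1)(n−k−di)} + Σ_{i=⌊(n−2k)/d⌋+1}^{⌊(n−k)/d⌋} ⌈q^{k(n−k+1−d(i+1))}⌉, where ⌈q^e⌉ = 1 when the exponent e is nonpositive. -/

import Mathlib

open Matrix Module

/-- The row space of a matrix, i.e. the span of its rows. -/
noncomputable def rowSpace (F : Type) [Field F] {k n : ℕ}
    (M : Matrix (Fin k) (Fin n) F) : Submodule F (Fin n → F) :=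
  Submodule.span F (Set.range M)

/-- The block matrix `[0_{k×l} | I_k | M]` of size `k × n`,
where `M` has size `k × (n - k - l)`. -/
def paddedLift (F : Type) [Field F] (k n l : ℕ)
    (M : Matrix (Fin k) (Fin (n - k - l)) F) : Matrix (Fin k) (Fin n) F :=
  fun i j =>
    if (j : ℕ) < l then 0
    else if h : (j : ℕ) < l + k then (if (j : ℕ) = l + (i : ℕ) then 1 else 0)
    else M i ⟨(j : ℕ) - (l + k), by have := j.isLt; omega⟩

/-- A rank-metric code `C` has minimum rank distance `d`. -/
def HasMinRankDist (F : Type) [Field F] {m n : ℕ}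
    (C : Set (Matrix (Fin m) (Fin n) F)) (d : ℕ) : Prop :=
  (∀ A ∈ C, ∀ B ∈ C, A ≠ B → d ≤ (A - B).rank) ∧
  ∃ A ∈ C, ∃ B ∈ C, A ≠ B ∧ (A - B).rank = d

/-- A rank-metric code is MRD if it has minimum rank distance `d` and attains
the Singleton-like bound. -/
def IsMRD (F : Type) [Field F] [Fintype F] {m n : ℕ}
    (C : Set (Matrix (Fin m) (Fin n) F)) (d : ℕ) : Prop :=
  HasMinRankDist F C d ∧
  Nat.card C = (Fintype.card F) ^ (max n m * (min n m - d + 1))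

/-- A constant dimension code `𝒞` of dimension `k` has minimum injection distance `d`. -/
def HasMinInjDist (F : Type) [Field F] {n : ℕ} (k : ℕ)
    (𝒞 : Set (Submodule F (Fin n → F))) (d : ℕ) : Prop :=
  (∀ U ∈ 𝒞, ∀ V ∈ 𝒞, U ≠ V → d ≤ k - finrank F ↥(U ⊓ V)) ∧
  ∃ U ∈ 𝒞, ∃ V ∈ 𝒞, U ≠ V ∧ k - finrank F ↥(U ⊓ V) = d

/-- `A_q(n,d,k)`: the maximal cardinality of a set of `k`-dimensional subspaces
of `F^n` whose pairwise injection distances are all at least `d`. -/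
noncomputable def maxConstDimCodeSize (F : Type) [Field F] [Fintype F]
    (n d k : ℕ) : ℕ :=
  sSup {N : ℕ | ∃ 𝒞 : Set (Submodule F (Fin n → F)),
    (∀ U ∈ 𝒞, Module.finrank F ↥U = k) ∧
    (∀ U ∈ 𝒞, ∀ V ∈ 𝒞, U ≠ V → d ≤ k - Module.finrank F ↥(U ⊓ V)) ∧
    Nat.card 𝒞 = N}

/-- The linearized polynomial map `x ↦ ∑ aᵢ x^(q^i)` as an `F`-linear map. -/
noncomputable def linPolyMap (F K : Type) [Field F] [Fintype F] [Field K] [Algebra F K] {r : ℕ}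
    (a : Fin r → K) : K →ₗ[F] K :=
  ∑ i : Fin r, (LinearMap.mulLeft F (a i)) ∘ₗ ((FiniteField.frobeniusAlgHom F K) ^ (i : ℕ)).toLinearMap

lemma linPolyMap_apply (F K : Type) [Field F] [Fintype F] [Field K] [Algebra F K] {r : ℕ}
    (a : Fin r → K) (x : K) :
    linPolyMap F K a x = ∑ i : Fin r, a i * x ^ (Fintype.card F ^ (i : ℕ)) := by
  simp [linPolyMap, LinearMap.sum_apply, AlgHom.coe_pow, FiniteField.coe_frobeniusAlgHom,
    pow_iterate]

lemma linPolyMap_sub (F K : Type) [Field F] [Fintype F] [Field K] [Algebra F K] {r : ℕ}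
    (a b : Fin r → K) : linPolyMap F K (a - b) = linPolyMap F K a - linPolyMap F K b := by
  ext x
  simp [linPolyMap_apply, sub_mul]

lemma linPolyMap_ker_card (F K : Type) [Field F] [Fintype F] [Field K] [Algebra F K] [Finite K]
    {r : ℕ} (a : Fin (r + 1) → K) (ha : a ≠ 0) :
    Nat.card (LinearMap.ker (linPolyMap F K a)) ≤ Fintype.card F ^ r := by
  classical
  have := Fintype.ofFinite K
  have hq : 1 < Fintype.card F := Fintype.one_lt_card
  let p : Polynomial K := ∑ i : Fin (r + 1), Polynomial.C (a i) * Polynomial.X ^ (Fintype.card F ^ (i : ℕ))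
  have hp : p ≠ 0 := by
    obtain ⟨j, hj⟩ := Function.ne_iff.mp ha
    intro h
    apply hj
    have h2 := congrArg (fun f => Polynomial.coeff f (Fintype.card F ^ (j : ℕ))) h
    simp only [p, Polynomial.finsetSum_coeff, Polynomial.coeff_C_mul, Polynomial.coeff_X_pow,
      Polynomial.coeff_zero] at h2
    rw [Finset.sum_eq_single j] at h2
    · simpa using h2
    · intro b _ hb
      rw [if_neg, mul_zero]
      intro h3
      exact hb (Fin.ext (Nat.pow_right_injective hq h3).symm)
    · simp
  have hdeg : p.natDegree ≤ Fintype.card F ^ r := by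
    apply Polynomial.natDegree_sum_le_of_forall_le
    intro i _
    refine (Polynomial.natDegree_C_mul_X_pow_le _ _).trans ?_
    exact Nat.pow_le_pow_right hq.le (by omega)
  have h := Polynomial.card_le_degree_of_subset_roots (p := p)
    (Z := Finset.univ.filter (fun x => linPolyMap F K a x = 0)) (by
      intro x hx
      rw [Polynomial.mem_roots hp]
      have hx' : linPolyMap F K a x = 0 := by simpa using hx
      rw [linPolyMap_apply] at hx'
      simp only [Polynomial.IsRoot, p, Polynomial.eval_finsetSum]
      simpa using hx')
  refine le_trans (le_of_eq ?_) (h.trans hdeg)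
  rw [Nat.card_eq_fintype_card, Fintype.card_subtype]
  simp

lemma exists_mrd (F : Type) [Field F] [Fintype F] (N M d : ℕ) (hd : 0 < d) (hdN : d ≤ N)
    (hNM : N ≤ M) : ∃ C : Finset (Matrix (Fin M) (Fin N) F),
      C.card = Fintype.card F ^ (M * (N - d + 1)) ∧
      ∀ A ∈ C, ∀ B ∈ C, A ≠ B → d ≤ (A - B).rank := by
  classical
  obtain ⟨p, hp⟩ := CharP.exists F
  have : Fact p.Prime := ⟨CharP.char_is_prime F p⟩
  have : NeZero M := ⟨by omega⟩
  let K := FiniteField.Extension F p M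
  have hK : finrank F K = M := FiniteField.finrank_extension F p M
  have hq : 1 < Fintype.card F := Fintype.one_lt_card
  have := Fintype.ofFinite K
  let e : K ≃ₗ[F] (Fin M → F) := LinearEquiv.ofFinrankEq _ _ (by simp [hK])
  obtain ⟨ι, hι⟩ : ∃ ι : (Fin N → F) →ₗ[F] K, Function.Injective ι := by
    refine ⟨e.symm.toLinearMap ∘ₗ Function.ExtendByZero.linearMap F (Fin.castLE hNM), ?_⟩
    rw [LinearMap.coe_comp]
    refine e.symm.injective.comp ?_
    intro x y hxy
    funext i
    have h : Function.extend (Fin.castLE hNM) x 0 (Fin.castLE hNM i) =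
      Function.extend (Fin.castLE hNM) y 0 (Fin.castLE hNM i) := congrFun hxy (Fin.castLE hNM i)
    rwa [(Fin.castLE_injective hNM).extend_apply, (Fin.castLE_injective hNM).extend_apply] at h
  let G : (Fin (N - d + 1) → K) → Matrix (Fin M) (Fin N) F := fun a =>
    LinearMap.toMatrix' (e.toLinearMap ∘ₗ linPolyMap F K a ∘ₗ ι)
  have key : ∀ a b, a ≠ b → d ≤ (G a - G b).rank := by
    intro a b hab
    have h1 : G a - G b = LinearMap.toMatrix' (e.toLinearMap ∘ₗ linPolyMap F K (a - b) ∘ₗ ι) := by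
      simp only [G]
      rw [← map_sub, linPolyMap_sub, LinearMap.sub_comp, LinearMap.comp_sub]
    rw [h1, Matrix.rank, ← Matrix.toLin'_apply', Matrix.toLin'_toMatrix']
    have h2 := LinearMap.finrank_range_add_finrank_ker (e.toLinearMap ∘ₗ linPolyMap F K (a - b) ∘ₗ ι)
    have h3 : finrank F (LinearMap.ker (e.toLinearMap ∘ₗ linPolyMap F K (a - b) ∘ₗ ι)) ≤ N - d := by
      have h4 : finrank F (LinearMap.ker (e.toLinearMap ∘ₗ linPolyMap F K (a - b) ∘ₗ ι)) ≤
          finrank F (LinearMap.ker (linPolyMap F K (a - b))) := by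
        rw [LinearEquiv.finrank_eq (Submodule.equivMapOfInjective ι hι _)]
        apply Submodule.finrank_mono
        rintro _ ⟨x, hx, rfl⟩
        simpa using hx
      refine h4.trans ?_
      have h5 := linPolyMap_ker_card F K (a - b) (sub_ne_zero.mpr hab)
      rw [Module.natCard_eq_pow_finrank (K := F), Nat.card_eq_fintype_card] at h5
      exact (Nat.pow_le_pow_iff_right hq).mp h5
    rw [Module.finrank_fin_fun] at h2
    omega
  have hG : Function.Injective G := by
    intro a b hab
    by_contra h
    have := key a b h
    rw [hab, sub_self, Matrix.rank_zero] at this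
    omega
  refine ⟨Finset.univ.image G, ?_, ?_⟩
  · rw [Finset.card_image_of_injective _ hG, Finset.card_univ, Fintype.card_fun, Fintype.card_fin,
      Module.card_eq_pow_finrank (K := F) (V := K), hK, ← pow_mul]
  · intro A hA B hB hAB
    obtain ⟨a, -, rfl⟩ := Finset.mem_image.mp hA
    obtain ⟨b, -, rfl⟩ := Finset.mem_image.mp hB
    exact key a b (fun h => hAB (by rw [h]))

/-- Size of the rank metric codes used. -/
def codeSize (q k m d : ℕ) : ℕ :=
  if k ≤ m then q ^ ((k - d + 1) * m) else if d ≤ m then q ^ (k * (m - d + 1)) else 1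

lemma exists_code (F : Type) [Field F] [Fintype F] (k m d : ℕ) (hd : 0 < d) (hdk : d ≤ k) :
    ∃ C : Finset (Matrix (Fin k) (Fin m) F),
      C.card = codeSize (Fintype.card F) k m d ∧
      ∀ A ∈ C, ∀ B ∈ C, A ≠ B → d ≤ (A - B).rank := by
  classical
  unfold codeSize
  split_ifs with h1 h2
  · obtain ⟨C, hC, hC'⟩ := exists_mrd F k m d hd hdk h1
    refine ⟨C.image Matrix.transpose, ?_, ?_⟩
    · rw [Finset.card_image_of_injective _ Matrix.transpose_injective, hC, mul_comm]
    · intro A hA B hB hAB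
      obtain ⟨a, ha, rfl⟩ := Finset.mem_image.mp hA
      obtain ⟨b, hb, rfl⟩ := Finset.mem_image.mp hB
      rw [← Matrix.transpose_sub, Matrix.rank_transpose]
      exact hC' a ha b hb (fun h => hAB (by rw [h]))
  · obtain ⟨C, hC, hC'⟩ := exists_mrd F m k d hd h2 (by omega)
    exact ⟨C, hC, hC'⟩
  · refine ⟨{0}, by simp, ?_⟩
    intro A hA B hB hAB
    simp only [Finset.mem_singleton] at hA hB
    exact absurd (hA.trans hB.symm) hAB

/-- The encoder `x ↦ (0_l, x, xA)`. -/
noncomputable def encMap (F : Type) [Field F] (k n l : ℕ)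
    (A : Matrix (Fin k) (Fin (n - k - l)) F) : (Fin k → F) →ₗ[F] (Fin n → F) :=
  Matrix.vecMulLinear (paddedLift F k n l A)

lemma encMap_left (F : Type) [Field F] (k n l : ℕ) (A : Matrix (Fin k) (Fin (n - k - l)) F)
    (x : Fin k → F) (j : Fin n) (hj : (j : ℕ) < l) : encMap F k n l A x j = 0 := by
  simp [encMap, Matrix.vecMul, dotProduct, paddedLift, hj]

lemma encMap_mid (F : Type) [Field F] (k n l : ℕ) (A : Matrix (Fin k) (Fin (n - k - l)) F)
    (x : Fin k → F) (i : Fin k) (hj : l + (i : ℕ) < n) :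
    encMap F k n l A x ⟨l + i, hj⟩ = x i := by
  simp [encMap, Matrix.vecMul, dotProduct, paddedLift, Fin.val_inj]

lemma encMap_right (F : Type) [Field F] (k n l : ℕ) (A : Matrix (Fin k) (Fin (n - k - l)) F)
    (x : Fin k → F) (i : Fin (n - k - l)) (hj : l + k + (i : ℕ) < n) :
    encMap F k n l A x ⟨l + k + i, hj⟩ = (x ᵥ* A) i := by
  have : ¬ (l + k + (i : ℕ) < l) := by omega
  simp [encMap, Matrix.vecMul, dotProduct, paddedLift, this]

lemma encMap_injective (F : Type) [Field F] (k n l : ℕ) (hl : l + k ≤ n)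
    (A : Matrix (Fin k) (Fin (n - k - l)) F) : Function.Injective (encMap F k n l A) := by
  intro x y h
  funext i
  have hi : l + (i : ℕ) < n := by omega
  rw [← encMap_mid F k n l A x i hi, h, encMap_mid]

lemma inter_same (F : Type) [Field F] (k n l d : ℕ) (hl : l + k ≤ n)
    (A B : Matrix (Fin k) (Fin (n - k - l)) F) (hAB : d ≤ (A - B).rank) :
    finrank F ↥(LinearMap.range (encMap F k n l A) ⊓ LinearMap.range (encMap F k n l B)) + d ≤ k := by
  have h1 : LinearMap.range (encMap F k n l A) ⊓ LinearMap.range (encMap F k n l B) ≤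
      (LinearMap.ker (Matrix.vecMulLinear (A - B))).map (encMap F k n l A) := by
    rintro v ⟨⟨x, rfl⟩, ⟨y, hy⟩⟩
    refine ⟨x, ?_, rfl⟩
    have hxy : y = x := by
      funext i
      have hi : l + (i : ℕ) < n := by omega
      rw [← encMap_mid F k n l B y i hi, hy, encMap_mid]
    subst hxy
    change y ᵥ* (A - B) = 0
    rw [Matrix.vecMul_sub, sub_eq_zero]
    funext i
    have hi : l + k + (i : ℕ) < n := by omega
    rw [← encMap_right F k n l A y i hi, ← hy, encMap_right]
  have h2 := Submodule.finrank_mono h1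
  have h3 := Submodule.finrank_map_le (encMap F k n l A) (LinearMap.ker (Matrix.vecMulLinear (A - B)))
  have h4 := LinearMap.finrank_range_add_finrank_ker (Matrix.vecMulLinear (A - B))
  rw [← Matrix.mulVecLin_transpose, Module.finrank_fin_fun] at h4
  rw [← Matrix.rank_transpose, Matrix.rank] at hAB
  rw [← Matrix.mulVecLin_transpose] at h2 h3
  omega

lemma inter_diff (F : Type) [Field F] (k n l l' d : ℕ) (hl : l' + k ≤ n) (hll : l + d ≤ l')
    (hdk : d ≤ k) (A : Matrix (Fin k) (Fin (n - k - l)) F)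
    (B : Matrix (Fin k) (Fin (n - k - l')) F) :
    finrank F ↥(LinearMap.range (encMap F k n l A) ⊓ LinearMap.range (encMap F k n l' B)) + d ≤ k := by
  let π : (Fin k → F) →ₗ[F] (Fin d → F) := LinearMap.funLeft F F (Fin.castLE hdk)
  have h1 : LinearMap.range (encMap F k n l A) ⊓ LinearMap.range (encMap F k n l' B) ≤
      (LinearMap.ker π).map (encMap F k n l A) := by
    rintro v ⟨⟨x, rfl⟩, ⟨y, hy⟩⟩
    refine ⟨x, ?_, rfl⟩
    change π x = 0
    funext i
    have hi : l + (Fin.castLE hdk i : ℕ) < n := by simp; omega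
    change x (Fin.castLE hdk i) = 0
    rw [← encMap_mid F k n l A x _ hi, ← hy, encMap_left]
    simp; omega
  have h2 := Submodule.finrank_mono h1
  have h3 := Submodule.finrank_map_le (encMap F k n l A) (LinearMap.ker π)
  have h4 := LinearMap.finrank_range_add_finrank_ker π
  have h5 : LinearMap.range π = ⊤ := LinearMap.range_eq_top.mpr
    (LinearMap.funLeft_surjective_of_injective F F _ (Fin.castLE_injective hdk))
  rw [h5, finrank_top, Module.finrank_fin_fun, Module.finrank_fin_fun] at h4
  omega

lemma code_bound (F : Type) [Field F] [Fintype F] (k n d : ℕ) (hd : 0 < d)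
    (hdk : d ≤ k) (hkn : k ≤ n) :
    ∑ i ∈ Finset.range ((n - k) / d + 1), codeSize (Fintype.card F) k (n - k - d * i) d
      ≤ maxConstDimCodeSize F n d k := by
  classical
  choose C hC hC' using fun i : ℕ => exists_code F k (n - k - d * i) d hd hdk
  let S := (Finset.range ((n - k) / d + 1)).sigma C
  let U : (Σ i : ℕ, Matrix (Fin k) (Fin (n - k - d * i)) F) → Submodule F (Fin n → F) :=
    fun s => LinearMap.range (encMap F k n (d * s.1) s.2)
  have hle : ∀ s ∈ S, d * s.1 + k ≤ n := by
    intro s hs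
    have h1 : s.1 < (n - k) / d + 1 := Finset.mem_range.mp (Finset.mem_sigma.mp hs).1
    have h2 : d * s.1 ≤ n - k := by
      rw [mul_comm]
      exact (Nat.le_div_iff_mul_le hd).mp (by omega)
    omega
  have hdim : ∀ s ∈ S, finrank F ↥(U s) = k := by
    intro s hs
    rw [LinearMap.finrank_range_of_inj (encMap_injective F k n _ (hle s hs) s.2),
      Module.finrank_fin_fun]
  have key : ∀ s ∈ S, ∀ t ∈ S, s ≠ t → finrank F ↥(U s ⊓ U t) + d ≤ k := by
    rintro ⟨i, A⟩ hs ⟨j, B⟩ ht hst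
    have hs' := hle _ hs
    have ht' := hle _ ht
    rcases lt_trichotomy i j with h | h | h
    · refine inter_diff F k n (d * i) (d * j) d ht' ?_ hdk A B
      nlinarith
    · subst h
      refine inter_same F k n (d * i) d hs' A B ?_
      exact hC' i A (Finset.mem_sigma.mp hs).2 B (Finset.mem_sigma.mp ht).2
        (fun h => hst (by rw [h]))
    · rw [inf_comm]
      refine inter_diff F k n (d * j) (d * i) d hs' ?_ hdk B A
      nlinarith
  have hinj : Set.InjOn U S := by
    intro s hs t ht hst
    by_contra h
    have h1 := key s hs t ht h
    rw [← hst, inf_idem, hdim s hs] at h1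
    omega
  apply le_csSup
  · have : Finite (Submodule F (Fin n → F)) := inferInstance
    refine ⟨Nat.card (Submodule F (Fin n → F)), ?_⟩
    rintro N ⟨D, -, -, rfl⟩
    exact Finite.card_subtype_le _
  · refine ⟨(S.image U : Finset _), ?_, ?_, ?_⟩
    · intro V hV
      obtain ⟨s, hs, rfl⟩ := Finset.mem_image.mp (Finset.mem_coe.mp hV)
      exact hdim s hs
    · intro V hV W hW hVW
      obtain ⟨s, hs, rfl⟩ := Finset.mem_image.mp (Finset.mem_coe.mp hV)
      obtain ⟨t, ht, rfl⟩ := Finset.mem_image.mp (Finset.mem_coe.mp hW)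
      have := key s hs t ht (fun h => hVW (by rw [h]))
      omega
    · rw [Nat.card_coe_set_eq, Set.ncard_coe_finset, Finset.card_image_of_injOn hinj,
        Finset.card_sigma]
      exact Finset.sum_congr rfl (fun i _ => hC i)

/-- **Lower bound on the size of constant dimension codes.**
`A_q(n,d,k) ≥ Σ_{i=0}^{⌊(n−2k)/d⌋} q^{(k−d+1)(n−k−di)}
            + Σ_{i=⌊(n−2k)/d⌋+1}^{⌊(n−k)/d⌋} ⌈q^{k(n−k+1−d(i+1))}⌉`,
where the ceiling of a nonpositive power of `q` equals `1`. -/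
theorem constant_dimension_code_lower_bound
    (q : ℕ) (F : Type) [Field F] [Fintype F] (hq : Fintype.card F = q)
    (k n d : ℕ) (hk : 0 < k) (hn : 0 < n) (hd : 0 < d)
    (hdk : d ≤ k) (h2k : 2 * k ≤ n) :
    (∑ i ∈ Finset.range ((n - 2 * k) / d + 1),
        (q : ℤ) ^ ((k - d + 1) * (n - k - d * i)))
      + (∑ i ∈ Finset.Icc ((n - 2 * k) / d + 1) ((n - k) / d),
          ⌈(q : ℚ) ^ ((k : ℤ) * ((n : ℤ) - k + 1 - d * (i + 1)))⌉)
      ≤ (maxConstDimCodeSize F n d k : ℤ) := by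
  have hq1 : 1 < q := hq ▸ Fintype.one_lt_card
  have hb := code_bound F k n d hd hdk (by omega)
  rw [hq] at hb
  have hTT : (n - 2 * k) / d ≤ (n - k) / d := Nat.div_le_div_right (by omega)
  rw [← Finset.sum_range_add_sum_Ico _ (show (n - 2 * k) / d + 1 ≤ (n - k) / d + 1 by omega)] at hb
  refine le_trans (le_of_eq ?_) (Int.ofNat_le.mpr hb)
  push_cast
  congr 1
  · refine Finset.sum_congr rfl fun i hi => ?_
    have h1 : i ≤ (n - 2 * k) / d := by have := Finset.mem_range.mp hi; omega
    have h2 : d * i ≤ n - 2 * k := by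
      rw [mul_comm]; exact (Nat.le_div_iff_mul_le hd).mp h1
    rw [codeSize, if_pos (by omega)]
    push_cast
    rfl
  · refine Finset.sum_congr (by ext; simp) fun i hi => ?_
    obtain ⟨h1, h1'⟩ := Finset.mem_Ico.mp hi
    have h2 : n - 2 * k < d * i := by
      rw [mul_comm d i]; exact (Nat.div_lt_iff_lt_mul hd).mp (show (n - 2 * k) / d < i by omega)
    have h3 : d * i ≤ n - k := by
      rw [mul_comm]; exact (Nat.le_div_iff_mul_le hd).mp (by omega)
    rw [codeSize, if_neg (by omega)]
    obtain ⟨m, hm⟩ : ∃ m, m = n - k - d * i := ⟨_, rfl⟩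
    have hm' : (n : ℤ) - k + 1 - d * (i + 1) = m - d + 1 := by
      have : (n : ℤ) = k + d * i + m := by
        have : n = k + d * i + m := by omega
        exact_mod_cast this
      rw [this]; ring
    rw [hm', ← hm]
    split_ifs with h4
    · have h5 : (k : ℤ) * (m - d + 1) = ((k * (m - d + 1) : ℕ) : ℤ) := by
        push_cast [h4]; ring
      rw [h5, zpow_natCast, ← Nat.cast_pow, Int.ceil_natCast]
    · have hqQ : (1 : ℚ) < q := by exact_mod_cast hq1
      have h5 : (k : ℤ) * (m - d + 1) ≤ 0 :=
        mul_nonpos_of_nonneg_of_nonpos (by positivity) (by omega)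
      rw [Nat.cast_one, Int.ceil_eq_iff]
      constructor
      · have : (0 : ℚ) < (q : ℚ) ^ ((k : ℤ) * (m - d + 1)) := by positivity
        simpa using this
      · simpa using zpow_le_one_of_nonpos₀ hqQ.le h5
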